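/- Assume that f_{n+1} < 4·p_n for all n ≥ 1. Then every even number x > 2 can be written as x = p + q with prime numbers p ≤ q satisfying x/4 < p ≤ x/2. -/

import Mathlib

open Filter Pointwise

/-- `nthPrime n` is the `n`-th prime number (1-indexed): `nthPrime 1 = 2`, etc. -/
noncomputable def nthPrime (n : ℕ) : ℕ := Nat.nth Nat.Prime (n - 1)

/-- `S n` is the additive submonoid of `ℕ` generated by the primes `q ≥ nthPrime n`. -/
def S (n : ℕ) : AddSubmonoid ℕ :=
  AddSubmonoid.closure {q : ℕ | q.Prime ∧ nthPrime n ≤ q}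

/-- `frob n` is the Frobenius number of `S n`: the largest natural number not in `S n`. -/
noncomputable def frob (n : ℕ) : ℕ := sSup {m : ℕ | m ∉ S n}

/-- `genus n` is the number of natural numbers not in `S n`. -/
noncomputable def genus (n : ℕ) : ℕ := {m : ℕ | m ∉ S n}.ncard

/-- `atoms n` is the minimal generating set `S n \ {0} \ ((S n \ {0}) + (S n \ {0}))`. -/
def atoms (n : ℕ) : Set ℕ :=
  ((S n : Set ℕ) \ {0}) \ (((S n : Set ℕ) \ {0}) + ((S n : Set ℕ) \ {0}))

/-- `u n` is the largest atom of `S n`. -/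
noncomputable def u (n : ℕ) : ℕ := sSup (atoms n)

/-- `e n` is the embedding dimension of `S n`: the number of atoms. -/
noncomputable def e (n : ℕ) : ℕ := (atoms n).ncard

theorem exists_forall_ge_mem_S (n : ℕ) : ∃ B, ∀ m ≥ B, m ∈ S n := by
  obtain ⟨p, hnp, hp⟩ := Nat.exists_infinite_primes (nthPrime n)
  obtain ⟨q, hpq, hq⟩ := Nat.exists_infinite_primes (p + 1)
  have hcop : p.Coprime q := (Nat.coprime_primes hp hq).2 (by omega)
  have hfrob := frobeniusNumber_pair hcop hp.one_lt hq.one_lt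
  rw [frobeniusNumber_iff] at hfrob
  refine ⟨p * q - p - q + 1, fun m hm => ?_⟩
  refine AddSubmonoid.closure_mono ?_ (hfrob.2 m (by omega))
  rintro r (rfl | rfl)
  · exact ⟨hp, hnp⟩
  · exact ⟨hq, by omega⟩

theorem mem_S_of_frob_lt {n m : ℕ} (hm : frob n < m) : m ∈ S n := by
  by_contra hmem
  obtain ⟨B, hB⟩ := exists_forall_ge_mem_S n
  have hbdd : BddAbove {m : ℕ | m ∉ S n} :=
    ⟨B, fun k hk => le_of_not_ge fun hBk => hk (hB k hBk)⟩
  exact absurd (le_csSup hbdd hmem) (not_le.2 hm)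

/-- An even element of `S n` that is small relative to `nthPrime n` is a sum of two primes. -/
theorem exists_add_of_even_mem_S {n x : ℕ} (hx : Even x) (hx2 : 2 < x) (hn : 2 < nthPrime n)
    (hlt : x < 4 * nthPrime n) (hmem : x ∈ S n) :
    ∃ p q : ℕ, p.Prime ∧ q.Prime ∧ nthPrime n ≤ p ∧ p ≤ q ∧ x = p + q := by
  obtain ⟨s, hs, rfl⟩ := AddSubmonoid.exists_multiset_of_mem_closure hmem
  have hodd : ∀ p ∈ s, p % 2 = 1 := fun p hp =>
    ((hs p hp).1.eq_two_or_odd).resolve_left fun h => by have := (hs p hp).2; omega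
  have hcard : s.card * nthPrime n ≤ s.sum := by
    simpa using Multiset.card_nsmul_le_sum fun p hp => (hs p hp).2
  have hcard4 : s.card < 4 := lt_of_mul_lt_mul_right (hcard.trans_lt hlt) (Nat.zero_le _)
  rw [Nat.even_iff] at hx
  interval_cases hc : s.card
  · simp [Multiset.card_eq_zero.1 hc] at hx2
  · obtain ⟨p, rfl⟩ := Multiset.card_eq_one.1 hc
    have := hodd p (by simp)
    simp at hx
    omega
  · obtain ⟨p, q, rfl⟩ := Multiset.card_eq_two.1 hc
    obtain ⟨hp, hnp⟩ := hs p (by simp)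
    obtain ⟨hq, hnq⟩ := hs q (by simp)
    rcases le_total p q with hpq | hqp
    · exact ⟨p, q, hp, hq, hnp, hpq, by simp⟩
    · exact ⟨q, p, hq, hp, hnq, hqp, by simp [add_comm]⟩
  · obtain ⟨p, q, r, rfl⟩ := Multiset.card_eq_three.1 hc
    have := hodd p (by simp)
    have := hodd q (by simp)
    have := hodd r (by simp)
    simp at hx
    omega

theorem exists_nthPrime_le_lt {y : ℕ} (hy : 2 ≤ y) :
    ∃ n ≥ 1, nthPrime n ≤ y ∧ y < nthPrime (n + 1) := by
  have hpos : 0 < Nat.count Nat.Prime (y + 1) :=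
    (Nat.count_strict_mono Nat.prime_two (by omega : 2 < y + 1)).pos
  refine ⟨Nat.count Nat.Prime (y + 1), hpos, ?_, ?_⟩
  · exact Nat.lt_succ_iff.1 (Nat.nth_lt_of_lt_count (Nat.sub_one_lt hpos.ne'))
  · exact Nat.le_nth_count Nat.infinite_setOfPred_prime (y + 1)

theorem goldbach_of_C2
    (h : ∀ n ≥ 1, frob (n + 1) < 4 * nthPrime n) :
    ∀ x : ℕ, Even x → 2 < x →
    ∃ p q : ℕ, p.Prime ∧ q.Prime ∧ p ≤ q ∧ x = p + q ∧
      x < 4 * p ∧ 2 * p ≤ x := by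
  intro x hx hx2
  rcases lt_or_ge x 8 with hx8 | hx8
  · rw [Nat.even_iff] at hx
    obtain rfl | rfl : x = 4 ∨ x = 6 := by omega
    · exact ⟨2, 2, by norm_num⟩
    · exact ⟨3, 3, by norm_num⟩
  · obtain ⟨n, hn, hle, hlt⟩ := exists_nthPrime_le_lt (y := x / 4) (by omega)
    have hfrob := h n hn
    obtain ⟨p, q, hp, hq, hnp, hpq, rfl⟩ := exists_add_of_even_mem_S hx hx2
      (by omega) (by omega) (mem_S_of_frob_lt (by omega : frob (n + 1) < x))
    exact ⟨p, q, hp, hq, hpq, rfl, by omega, by omega⟩
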